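/- The class Av({Q₁, Q₂}) of binary matrices avoiding both Q₁ and Q₂ as interval minors is bounded, i.e., it is both row-bounded and column-bounded, even though each of the classes Av(Q₁) and Av(Q₂) individually is unbounded. -/

import Mathlib

/-!
Common framework: binary matrices, interval minors, criticality, 0-runs,
row/column complexity, embeddings and related notions, following
Jelínek–Kučera, "On the structure of matrices avoiding interval-minor
patterns". All indices are 0-based.
-/

/-- A binary matrix: dimensions `m × n`, with entries given by a total
function (entries outside the range `[0,m) × [0,n)` are irrelevant:
all definitions below only inspect in-range entries). -/
structure BMat where
  m : ℕ
  n : ℕ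
  entry : ℕ → ℕ → Bool

namespace BMat

/-- The support of a binary matrix: its set of (in-range) 1-entries. -/
def supp (M : BMat) : Set (ℕ × ℕ) :=
  {p | p.1 < M.m ∧ p.2 < M.n ∧ M.entry p.1 p.2 = true}

/-- `M'` is obtained from `M` by contracting two adjacent rows `r`, `r+1`. -/
def RowCon (M M' : BMat) : Prop :=
  ∃ r, r + 1 < M.m ∧ M'.m + 1 = M.m ∧ M'.n = M.n ∧
    ∀ i j, i < M'.m → j < M'.n →
      M'.entry i j =
        if i < r then M.entry i j
        else if i = r then (M.entry r j || M.entry (r + 1) j)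
        else M.entry (i + 1) j

/-- `M'` is obtained from `M` by contracting two adjacent columns `c`, `c+1`. -/
def ColCon (M M' : BMat) : Prop :=
  ∃ c, c + 1 < M.n ∧ M'.n + 1 = M.n ∧ M'.m = M.m ∧
    ∀ i j, i < M'.m → j < M'.n →
      M'.entry i j =
        if j < c then M.entry i j
        else if j = c then (M.entry i c || M.entry i (c + 1))
        else M.entry i (j + 1)

/-- One contraction step (of a row or of a column). -/
def Con (M M' : BMat) : Prop := RowCon M M' ∨ ColCon M M'

/-- `P` is an interval minor of `M`: `M` can be transformed by a sequence of
row and column contractions into a matrix of the same dimensions as `P`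
dominating `P`. -/
def IntervalMinor (P M : BMat) : Prop :=
  ∃ M', Relation.ReflTransGen Con M M' ∧ M'.m = P.m ∧ M'.n = P.n ∧
    ∀ i j, i < P.m → j < P.n → P.entry i j = true → M'.entry i j = true

/-- `M` avoids `P` as an interval minor. -/
def Avoids (P M : BMat) : Prop := ¬ IntervalMinor P M

/-- The class of all matrices avoiding `P` as an interval minor. -/
def Av (P : BMat) : Set BMat := {M | Avoids P M}

/-- The class of all matrices avoiding every pattern of `F` as an interval
minor. -/
def AvF (F : Set BMat) : Set BMat := {M | ∀ P ∈ F, Avoids P M}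

/-- The matrix obtained from `M` by changing the entry at position `(i, j)`
into a 1-entry. -/
def setOne (M : BMat) (i j : ℕ) : BMat :=
  ⟨M.m, M.n, fun a b => if a = i ∧ b = j then true else M.entry a b⟩

/-- `M` is critical for the class `C`: it lies in `C`, but changing any
single 0-entry of `M` into a 1-entry leaves `C`. -/
def CriticalFor (C : Set BMat) (M : BMat) : Prop :=
  M ∈ C ∧ ∀ i j, i < M.m → j < M.n → M.entry i j = false → setOne M i j ∉ C

/-- The number of horizontal 0-runs in row `r` of `M`, counted via their
starting columns. -/
noncomputable def rowRunCount (M : BMat) (r : ℕ) : ℕ :=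
  Set.ncard {j | j < M.n ∧ M.entry r j = false ∧ (j = 0 ∨ M.entry r (j - 1) = true)}

/-- The number of vertical 0-runs in column `c` of `M`. -/
noncomputable def colRunCount (M : BMat) (c : ℕ) : ℕ :=
  Set.ncard {i | i < M.m ∧ M.entry i c = false ∧ (i = 0 ∨ M.entry (i - 1) c = true)}

/-- A class is row-bounded if there is a uniform bound on the number of
0-runs in any row of any matrix that is critical for the class. -/
def RowBounded (C : Set BMat) : Prop :=
  ∃ K, ∀ M, CriticalFor C M → ∀ r, r < M.m → rowRunCount M r ≤ K

/-- A class is column-bounded if there is a uniform bound on the number of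
0-runs in any column of any matrix that is critical for the class. -/
def ColBounded (C : Set BMat) : Prop :=
  ∃ K, ∀ M, CriticalFor C M → ∀ c, c < M.n → colRunCount M c ≤ K

/-- A class is bounded if it is both row-bounded and column-bounded. -/
def Bounded (C : Set BMat) : Prop := RowBounded C ∧ ColBounded C

/-- The pattern `Q₁`, with support `{(1,2),(2,1),(3,3)}` (1-based). -/
def Q1 : BMat :=
  ⟨3, 3, fun i j => (i == 0 && j == 1) || (i == 1 && j == 0) || (i == 2 && j == 2)⟩

/-- The pattern `Q₂`, with support `{(1,2),(2,3),(3,1)}` (1-based). -/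
def Q2 : BMat :=
  ⟨3, 3, fun i j => (i == 0 && j == 1) || (i == 1 && j == 2) || (i == 2 && j == 0)⟩

/-- The pattern `Q₃`, with support `{(1,1),(2,3),(3,2)}` (1-based). -/
def Q3 : BMat :=
  ⟨3, 3, fun i j => (i == 0 && j == 0) || (i == 1 && j == 2) || (i == 2 && j == 1)⟩

/-- The pattern `Q₄`, with support `{(1,3),(2,1),(3,2)}` (1-based). -/
def Q4 : BMat :=
  ⟨3, 3, fun i j => (i == 0 && j == 2) || (i == 1 && j == 0) || (i == 2 && j == 1)⟩

/-- The diagonal pattern `D_k`, with support `{(i,i) : i ∈ [k]}`. -/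
def D (k : ℕ) : BMat := ⟨k, k, fun i j => i == j⟩

/-- The antidiagonal pattern `D̄_k`, with support `{(i, k+1-i) : i ∈ [k]}`
(1-based). -/
def Dbar (k : ℕ) : BMat := ⟨k, k, fun i j => i + j + 1 == k⟩

/-- An embedding of `P` into `M`: 1-entries go to 1-entries, and the map is
strictly monotone in rows and in columns. -/
def IsEmbedding (P M : BMat) (φ : ℕ → ℕ → ℕ × ℕ) : Prop :=
  (∀ i j, i < P.m → j < P.n → (φ i j).1 < M.m ∧ (φ i j).2 < M.n) ∧
  (∀ i j, i < P.m → j < P.n → P.entry i j = true →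
      M.entry (φ i j).1 (φ i j).2 = true) ∧
  (∀ i₁ j₁ i₂ j₂, i₁ < P.m → j₁ < P.n → i₂ < P.m → j₂ < P.n →
      (i₁ < i₂ → (φ i₁ j₁).1 < (φ i₂ j₂).1) ∧
      (j₁ < j₂ → (φ i₁ j₁).2 < (φ i₂ j₂).2))

/-- A partition of `M` containing `P` (via row indices `r 0 < ⋯ < r P.m ≤ M.m`
and column indices `c 0 < ⋯ < c P.n ≤ M.n`). -/
def PartitionContains (M P : BMat) : Prop :=
  ∃ r c : ℕ → ℕ,
    (∀ i, i < P.m → r i < r (i + 1)) ∧ (∀ j, j < P.n → c j < c (j + 1)) ∧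
    r P.m ≤ M.m ∧ c P.n ≤ M.n ∧
    ∀ i j, i < P.m → j < P.n → P.entry i j = true →
      ∃ a b, r i ≤ a ∧ a < r (i + 1) ∧ c j ≤ b ∧ b < c (j + 1) ∧
        M.entry a b = true

/-- A partial embedding of `P` into `M`, defined on a nonempty set `S` of
entries of `P`. -/
def IsPartialEmbedding (P M : BMat) (S : Set (ℕ × ℕ)) (ψ : ℕ × ℕ → ℕ × ℕ) : Prop :=
  S.Nonempty ∧ (∀ e ∈ S, e.1 < P.m ∧ e.2 < P.n) ∧
  (∀ i j, i < P.m → j < P.n → P.entry i j = true →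
      (i, j) ∈ S ∧ M.entry (ψ (i, j)).1 (ψ (i, j)).2 = true) ∧
  (∀ e ∈ S, (ψ e).1 < M.m ∧ (ψ e).2 < M.n ∧
      e.1 ≤ (ψ e).1 ∧ e.2 ≤ (ψ e).2 ∧
      P.m - 1 - e.1 ≤ M.m - 1 - (ψ e).1 ∧ P.n - 1 - e.2 ≤ M.n - 1 - (ψ e).2) ∧
  (∀ e₁ ∈ S, ∀ e₂ ∈ S,
      (e₁.1 < e₂.1 → e₂.1 - e₁.1 ≤ (ψ e₂).1 - (ψ e₁).1) ∧
      (e₁.2 < e₂.2 → e₂.2 - e₁.2 ≤ (ψ e₂).2 - (ψ e₁).2))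

/-- A horizontal 0-run of `M` in row `r`, occupying exactly columns
`c₁, …, c₂`. -/
def ZeroRun (M : BMat) (r c₁ c₂ : ℕ) : Prop :=
  r < M.m ∧ c₁ ≤ c₂ ∧ c₂ < M.n ∧
  (∀ j, c₁ ≤ j → j ≤ c₂ → M.entry r j = false) ∧
  (c₁ = 0 ∨ M.entry r (c₁ - 1) = true) ∧
  (c₂ + 1 = M.n ∨ M.entry r (c₂ + 1) = true)

/-- The 0-entry `f` of `M` is critical for the 1-entry `e` of `P`: some
embedding of `P` into `M △ f` maps `e` to `f`. -/
def CritEntry (P : BMat) (e : ℕ × ℕ) (M : BMat) (f : ℕ × ℕ) : Prop :=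
  f.1 < M.m ∧ f.2 < M.n ∧ M.entry f.1 f.2 = false ∧
  ∃ φ, IsEmbedding P (setOne M f.1 f.2) φ ∧ φ e.1 e.2 = f

/-- The number of horizontal 0-runs in row `r` of `M` that are critical for
the 1-entry `e` of `P` (counted via their starting columns). -/
noncomputable def critRunCount (P : BMat) (e : ℕ × ℕ) (M : BMat) (r : ℕ) : ℕ :=
  Set.ncard {c₁ | ∃ c₂, ZeroRun M r c₁ c₂ ∧
    ∃ c, c₁ ≤ c ∧ c ≤ c₂ ∧ CritEntry P e M (r, c)}

/-- The 1-entry `e` of `P` is row-bounding: every row of every `P`-avoiding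
matrix contains a bounded number of 0-runs critical for `e`. -/
def EntryRowBounding (P : BMat) (e : ℕ × ℕ) : Prop :=
  ∃ K, ∀ M, Avoids P M → ∀ r, critRunCount P e M r ≤ K

/-- An increasing walk from `e` to `e'`: a sequence of positions, each step
moving one column to the right or one row up, with `W` its set of
positions. -/
def IsIncreasingWalk (W : Set (ℕ × ℕ)) (e e' : ℕ × ℕ) : Prop :=
  ∃ (t : ℕ) (f : ℕ → ℕ × ℕ), f 0 = e ∧ f t = e' ∧
    W = {x | ∃ i, i ≤ t ∧ f i = x} ∧
    ∀ i, i < t →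
      ((f (i + 1)).1 = (f i).1 ∧ (f (i + 1)).2 = (f i).2 + 1) ∨
      ((f (i + 1)).1 + 1 = (f i).1 ∧ (f (i + 1)).2 = (f i).2)

/-- All 1-entries of `P` can be covered by at most `k` lines
(rows or columns). -/
def CoveredByLines (P : BMat) (k : ℕ) : Prop :=
  ∃ (R C : Finset ℕ), R.card + C.card ≤ k ∧
    ∀ i j, i < P.m → j < P.n → P.entry i j = true → i ∈ R ∨ j ∈ C

/-- Clockwise rotation by 90 degrees. -/
def rot90 (P : BMat) : BMat := ⟨P.n, P.m, fun i j => P.entry (P.m - 1 - j) i⟩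

/-- Rotation by 180 degrees. -/
def rot180 (P : BMat) : BMat :=
  ⟨P.m, P.n, fun i j => P.entry (P.m - 1 - i) (P.n - 1 - j)⟩

/-- Clockwise rotation by 270 degrees. -/
def rot270 (P : BMat) : BMat := ⟨P.n, P.m, fun i j => P.entry j (P.n - 1 - i)⟩

/-- Reflection turning the matrix upside down (reversing the rows). -/
def reflRows (P : BMat) : BMat := ⟨P.m, P.n, fun i j => P.entry (P.m - 1 - i) j⟩

/-- Reflection reversing the columns. -/
def reflCols (P : BMat) : BMat := ⟨P.m, P.n, fun i j => P.entry i (P.n - 1 - j)⟩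

/-- Reflection along the main diagonal (transposition). -/
def transposeB (P : BMat) : BMat := ⟨P.n, P.m, fun i j => P.entry j i⟩

/-- Reflection along the antidiagonal. -/
def antitransposeB (P : BMat) : BMat :=
  ⟨P.n, P.m, fun i j => P.entry (P.m - 1 - j) (P.n - 1 - i)⟩

/-- Type 1 pattern of Lemma `lem-2types`: rows `r < r' < r''`, columns
`c < c'`, with `supp ⊆ ({r'} × [c,c']) ∪ {(r,c),(r'',c),(r,c'),(r'',c')}`. -/
def TypeOne (P₀ : BMat) : Prop :=
  ∃ r r' r'' c c', r < r' ∧ r' < r'' ∧ r'' < P₀.m ∧ c < c' ∧ c' < P₀.n ∧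
    ∀ i j, i < P₀.m → j < P₀.n → P₀.entry i j = true →
      (i = r' ∧ c ≤ j ∧ j ≤ c') ∨ ((i = r ∨ i = r'') ∧ (j = c ∨ j = c'))

/-- Type 2 pattern of Lemma `lem-2types`: rows `r < r'`, columns `c < c'`,
with `supp ⊆ ({r} × [c,c']) ∪ ({r'} × [1,c]) ∪ ([1,r] × {c'}) ∪ {(r',c')}`. -/
def TypeTwo (P₀ : BMat) : Prop :=
  ∃ r r' c c', r < r' ∧ r' < P₀.m ∧ c < c' ∧ c' < P₀.n ∧
    ∀ i j, i < P₀.m → j < P₀.n → P₀.entry i j = true →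
      (i = r ∧ c ≤ j ∧ j ≤ c') ∨ (i = r' ∧ j ≤ c) ∨ (i ≤ r ∧ j = c') ∨
      (i = r' ∧ j = c')

/-- A minor-closed class of binary matrices. -/
def MinorClosed (C : Set BMat) : Prop :=
  ∀ M ∈ C, ∀ P, IntervalMinor P M → P ∈ C

/-- The 4×3 pattern with support `{(1,2),(2,1),(3,2),(4,3)}` (1-based), from
Proposition `pro-counter`. -/
def P18 : BMat :=
  ⟨4, 3, fun i j => (i == 0 && j == 1) || (i == 1 && j == 0) ||
    (i == 2 && j == 1) || (i == 3 && j == 2)⟩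

end BMat

open BMat

namespace BMat

/-- Explicit containment: `t = true` for `Q1`, `t = false` for `Q2`. -/
def H (t : Bool) (M : BMat) : Prop :=
  ∃ a b c x y z, a < b ∧ b < c ∧ c < M.m ∧ x < y ∧ y < z ∧ z < M.n ∧
    M.entry a y = true ∧ M.entry b (if t then x else z) = true ∧
    M.entry c (if t then z else x) = true

theorem pull_row {M M' : BMat} {t : Bool} (h : RowCon M M') (hH : H t M') : H t M := by
  obtain ⟨r, hr, hm, hn, he⟩ := h
  obtain ⟨a, b, c, x, y, z, hab, hbc, hc, hxy, hyz, hz, h1, h2, h3⟩ := hH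
  have key : ∀ i j, i < M'.m → j < M'.n → M'.entry i j = true →
      ∃ i', M.entry i' j = true ∧ ((i' = i ∧ i ≤ r) ∨ (i' = i + 1 ∧ r ≤ i)) := by
    intro i j hi hj h
    rw [he i j hi hj] at h
    split_ifs at h with h4 h5
    · exact ⟨i, h, by omega⟩
    · rcases Bool.or_eq_true_iff.1 h with h | h
      · exact ⟨r, h, by omega⟩
      · exact ⟨r + 1, h, by omega⟩
    · exact ⟨i + 1, h, by omega⟩
  obtain ⟨a', ha1, ha2⟩ := key a _ (by omega) (by omega) h1
  obtain ⟨b', hb1, hb2⟩ := key b _ (by omega) (by split <;> omega) h2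
  obtain ⟨c', hc1, hc2⟩ := key c _ (by omega) (by split <;> omega) h3
  exact ⟨a', b', c', x, y, z, by omega, by omega, by omega, hxy, hyz, by omega, ha1, hb1, hc1⟩

theorem pull_col {M M' : BMat} {t : Bool} (h : ColCon M M') (hH : H t M') : H t M := by
  obtain ⟨r, hr, hm, hn, he⟩ := h
  obtain ⟨a, b, c, x, y, z, hab, hbc, hc, hxy, hyz, hz, h1, h2, h3⟩ := hH
  have key : ∀ i j, i < M'.m → j < M'.n → M'.entry i j = true →
      ∃ j', M.entry i j' = true ∧ ((j' = j ∧ j ≤ r) ∨ (j' = j + 1 ∧ r ≤ j)) := by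
    intro i j hi hj h
    rw [he i j hi hj] at h
    split_ifs at h with h4 h5
    · exact ⟨j, h, by omega⟩
    · rcases Bool.or_eq_true_iff.1 h with h | h
      · exact ⟨r, h, by omega⟩
      · exact ⟨r + 1, h, by omega⟩
    · exact ⟨j + 1, h, by omega⟩
  obtain ⟨y', ha1, ha2⟩ := key a _ (by omega) (by omega) h1
  obtain ⟨u, hb1, hb2⟩ := key b _ (by omega) (by split <;> omega) h2
  obtain ⟨v, hc1, hc2⟩ := key c _ (by omega) (by split <;> omega) h3
  cases t
  · simp only [Bool.false_eq_true, if_false] at *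
    exact ⟨a, b, c, v, y', u, by omega, by omega, by omega, by omega, by omega, by omega,
      ha1, by simpa using hb1, by simpa using hc1⟩
  · simp only [if_true] at *
    exact ⟨a, b, c, u, y', v, by omega, by omega, by omega, by omega, by omega, by omega,
      ha1, by simpa using hb1, by simpa using hc1⟩

theorem pull_star {M M' : BMat} {t : Bool} (h : Relation.ReflTransGen Con M M') (hH : H t M') :
    H t M := by
  induction h using Relation.ReflTransGen.head_induction_on with
  | refl => exact hH
  | head h _ ih =>
    rcases h with h | h
    · exact pull_row h ih
    · exact pull_col h ih

/-- Index of a contraction of an `m > 3` line family preserving three chosen lines. -/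
theorem choose_con (a b c m : ℕ) (hab : a < b) (hbc : b < c) (hc : c < m) (hm : 3 < m) :
    ∃ r, r + 1 < m ∧ ∃ a' b' c', a' < b' ∧ b' < c' ∧ c' + 1 < m ∧
      ((a' = a ∧ a ≤ r) ∨ (a' + 1 = a ∧ r < a)) ∧
      ((b' = b ∧ b ≤ r) ∨ (b' + 1 = b ∧ r < b)) ∧
      ((c' = c ∧ c ≤ r) ∨ (c' + 1 = c ∧ r < c)) := by
  by_cases h1 : 1 ≤ a
  · exact ⟨0, by omega, a - 1, b - 1, c - 1, by omega, by omega, by omega, by omega, by omega,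
      by omega⟩
  by_cases h2 : a + 2 ≤ b
  · exact ⟨a, by omega, a, b - 1, c - 1, by omega, by omega, by omega, by omega, by omega,
      by omega⟩
  by_cases h3 : b + 2 ≤ c
  · exact ⟨b, by omega, a, b, c - 1, by omega, by omega, by omega, by omega, by omega,
      by omega⟩
  exact ⟨c, by omega, a, b, c, by omega, by omega, by omega, by omega, by omega,
      by omega⟩

theorem push_star (t : Bool) (k : ℕ) : ∀ M : BMat, M.m + M.n = k → H t M →
    ∃ M', Relation.ReflTransGen Con M M' ∧ M'.m = 3 ∧ M'.n = 3 ∧ H t M' := by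
  induction k with
  | zero =>
    rintro M hk ⟨a, b, c, x, y, z, h⟩
    omega
  | succ k ih =>
    intro M hk hH
    by_cases hm : 3 < M.m
    · obtain ⟨a, b, c, x, y, z, hab, hbc, hc, hxy, hyz, hz, h1, h2, h3⟩ := hH
      obtain ⟨r, hr, a', b', c', h4, h5, h6, h7, h8, h9⟩ := choose_con a b c M.m hab hbc hc hm
      let N : BMat := ⟨M.m - 1, M.n, fun i j => if i < r then M.entry i j
        else if i = r then (M.entry r j || M.entry (r + 1) j)
        else M.entry (i + 1) j⟩
      have hN : Con M N := Or.inl ⟨r, hr, by simp only [N]; omega, rfl, fun i j _ _ => rfl⟩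
      have key : ∀ i i' j, M.entry i j = true → ((i' = i ∧ i ≤ r) ∨ (i' + 1 = i ∧ r < i)) →
          N.entry i' j = true := by
        intro i i' j h hi
        simp only [N]
        split_ifs with e1 e2
        · rcases hi with hi | hi
          · rw [hi.1]; exact h
          · omega
        · rcases hi with hi | hi
          · have : i = r := by omega
            subst this; simp [h]
          · have : i = r + 1 := by omega
            subst this; simp [h]
        · have : i = i' + 1 := by omega
          subst this; exact h
      obtain ⟨M', s1, s2⟩ := ih N (by simp only [N]; omega)
        ⟨a', b', c', x, y, z, h4, h5, by simp only [N]; omega, hxy, hyz, hz,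
          key _ _ _ h1 h7, key _ _ _ h2 h8, key _ _ _ h3 h9⟩
      exact ⟨M', Relation.ReflTransGen.head hN s1, s2⟩
    by_cases hn : 3 < M.n
    · obtain ⟨a, b, c, x, y, z, hab, hbc, hc, hxy, hyz, hz, h1, h2, h3⟩ := hH
      obtain ⟨r, hr, x', y', z', h4, h5, h6, h7, h8, h9⟩ := choose_con x y z M.n hxy hyz hz hn
      let N : BMat := ⟨M.m, M.n - 1, fun i j => if j < r then M.entry i j
        else if j = r then (M.entry i r || M.entry i (r + 1))
        else M.entry i (j + 1)⟩
      have hN : Con M N := Or.inr ⟨r, hr, by simp only [N]; omega, rfl, fun i j _ _ => rfl⟩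
      have key : ∀ i j j', M.entry i j = true → ((j' = j ∧ j ≤ r) ∨ (j' + 1 = j ∧ r < j)) →
          N.entry i j' = true := by
        intro i j j' h hi
        simp only [N]
        split_ifs with e1 e2
        · rcases hi with hi | hi
          · rw [hi.1]; exact h
          · omega
        · rcases hi with hi | hi
          · have : j = r := by omega
            subst this; simp [h]
          · have : j = r + 1 := by omega
            subst this; simp [h]
        · have : j = j' + 1 := by omega
          subst this; exact h
      have hNH : H t N := by
        refine ⟨a, b, c, x', y', z', hab, hbc, hc, h4, h5, by simp only [N]; omega,
          key _ _ _ h1 h8, key _ _ _ h2 ?_, key _ _ _ h3 ?_⟩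
        · cases t
          · simpa using h9
          · simpa using h7
        · cases t
          · simpa using h7
          · simpa using h9
      obtain ⟨M', s1, s2⟩ := ih N (by simp only [N]; omega) hNH
      exact ⟨M', Relation.ReflTransGen.head hN s1, s2⟩
    · have : M.m = 3 ∧ M.n = 3 := by
        obtain ⟨a, b, c, x, y, z, h⟩ := hH
        omega
      exact ⟨M, Relation.ReflTransGen.refl, this.1, this.2, hH⟩

/-- `Q1` or `Q2`. -/
def Qt (t : Bool) : BMat := if t then Q1 else Q2

theorem minor_iff (t : Bool) (M : BMat) : IntervalMinor (Qt t) M ↔ H t M := by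
  constructor
  · rintro ⟨M', h1, h2, h3, h4⟩
    refine pull_star h1 ?_
    cases t
    · simp only [Qt, Bool.false_eq_true, if_false] at *
      refine ⟨0, 1, 2, 0, 1, 2, by omega, by omega, ?_, by omega, by omega, ?_, ?_, ?_, ?_⟩
      · rw [h2]; decide
      · rw [h3]; decide
      · exact h4 0 1 (by decide) (by decide) (by decide)
      · exact h4 1 2 (by decide) (by decide) (by decide)
      · exact h4 2 0 (by decide) (by decide) (by decide)
    · simp only [Qt, if_true] at *
      refine ⟨0, 1, 2, 0, 1, 2, by omega, by omega, ?_, by omega, by omega, ?_, ?_, ?_, ?_⟩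
      · rw [h2]; decide
      · rw [h3]; decide
      · exact h4 0 1 (by decide) (by decide) (by decide)
      · exact h4 1 0 (by decide) (by decide) (by decide)
      · exact h4 2 2 (by decide) (by decide) (by decide)
  · intro h
    obtain ⟨M', s1, s2, s3, a, b, c, x, y, z, hab, hbc, hc, hxy, hyz, hz, h1, h2, h3⟩ :=
      push_star t _ M rfl h
    obtain ⟨rfl, rfl, rfl⟩ : a = 0 ∧ b = 1 ∧ c = 2 := by omega
    obtain ⟨rfl, rfl, rfl⟩ : x = 0 ∧ y = 1 ∧ z = 2 := by omega
    refine ⟨M', s1, ?_, ?_, ?_⟩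
    · cases t <;> simp [Qt, Q1, Q2, s2]
    · cases t <;> simp [Qt, Q1, Q2, s3]
    · intro i j _ _ hij
      cases t
      · simp [Qt, Q2] at hij h1 h2 h3
        rcases hij with (⟨rfl, rfl⟩ | ⟨rfl, rfl⟩) | ⟨rfl, rfl⟩ <;> assumption
      · simp [Qt, Q1] at hij h1 h2 h3
        rcases hij with (⟨rfl, rfl⟩ | ⟨rfl, rfl⟩) | ⟨rfl, rfl⟩ <;> assumption

theorem mem_Av (t : Bool) (M : BMat) : M ∈ Av (Qt t) ↔ ¬ H t M := by
  rw [← minor_iff]; rfl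

/-- Violation of the class `Av {Q1, Q2}`. -/
def V (M : BMat) : Prop :=
  ∃ a y b x c z, a < b ∧ a < c ∧ b ≠ c ∧ x < y ∧ y < z ∧ b < M.m ∧ c < M.m ∧ z < M.n ∧
    M.entry a y = true ∧ M.entry b x = true ∧ M.entry c z = true

theorem mem_AvF (M : BMat) : M ∈ AvF {Q1, Q2} ↔ ¬ V M := by
  have e : M ∈ AvF {Q1, Q2} ↔ ¬ H true M ∧ ¬ H false M := by
    rw [← minor_iff, ← minor_iff]
    simp [AvF, Avoids, Qt]
  rw [e, ← not_or]
  refine not_congr ⟨?_, ?_⟩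
  · rintro (⟨a, b, c, x, y, z, hab, hbc, hc, hxy, hyz, hz, h1, h2, h3⟩ |
      ⟨a, b, c, x, y, z, hab, hbc, hc, hxy, hyz, hz, h1, h2, h3⟩)
    · exact ⟨a, y, b, x, c, z, by omega, by omega, by omega, by omega, by omega, by omega,
        by omega, by omega, h1, by simpa using h2, by simpa using h3⟩
    · exact ⟨a, y, c, x, b, z, by omega, by omega, by omega, by omega, by omega, by omega,
        by omega, by omega, h1, by simpa using h3, by simpa using h2⟩
  · rintro ⟨a, y, b, x, c, z, h1, h2, h3, h4, h5, h6, h7, h8, h9, h10, h11⟩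
    rcases Nat.lt_or_gt_of_ne h3 with h | h
    · exact Or.inl ⟨a, b, c, x, y, z, by omega, by omega, by omega, by omega, by omega,
        by omega, h9, by simpa using h10, by simpa using h11⟩
    · exact Or.inr ⟨a, c, b, x, y, z, by omega, by omega, by omega, by omega, by omega,
        by omega, h9, by simpa using h11, by simpa using h10⟩

/-- top type -/
def TT (M : BMat) (r c : ℕ) : Prop :=
  ∃ b x b' z, r < b ∧ r < b' ∧ b ≠ b' ∧ x < c ∧ c < z ∧ b < M.m ∧ b' < M.m ∧ z < M.n ∧
    M.entry b x = true ∧ M.entry b' z = true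

/-- left type -/
def TL (M : BMat) (r c : ℕ) : Prop :=
  ∃ a y b z, a < r ∧ a < b ∧ r ≠ b ∧ c < y ∧ y < z ∧ b < M.m ∧ z < M.n ∧
    M.entry a y = true ∧ M.entry b z = true

/-- right type -/
def TR (M : BMat) (r c : ℕ) : Prop :=
  ∃ a y b x, a < r ∧ a < b ∧ r ≠ b ∧ x < y ∧ y < c ∧ b < M.m ∧
    M.entry a y = true ∧ M.entry b x = true

theorem types {M : BMat} (hM : CriticalFor (AvF {Q1, Q2}) M) {r c : ℕ} (hr : r < M.m)
    (hc : c < M.n) (h0 : M.entry r c = false) : TT M r c ∨ TL M r c ∨ TR M r c := by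
  have h1 := hM.2 r c hr hc h0
  have hV := (mem_AvF _).1 hM.1
  rw [mem_AvF, not_not] at h1
  obtain ⟨a, y, b, x, d, z, h1, h2, h3, h4, h5, h6, h7, h8, h9, h10, h11⟩ := h1
  have key : ∀ i j, (setOne M r c).entry i j = true → (i = r ∧ j = c) ∨ M.entry i j = true := by
    intro i j h
    by_cases h' : i = r ∧ j = c
    · exact Or.inl h'
    · right; simpa [setOne, h'] using h
  have k9 := key _ _ h9
  have k10 := key _ _ h10
  have k11 := key _ _ h11
  simp only [setOne] at h6 h7 h8
  rcases k9 with ⟨rfl, rfl⟩ | k9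
  · exact Or.inl ⟨b, x, d, z, h1, h2, h3, h4, h5, h6, h7, h8,
      k10.resolve_left (by omega), k11.resolve_left (by omega)⟩
  rcases k10 with ⟨rfl, rfl⟩ | k10
  · exact Or.inr (Or.inl ⟨a, y, d, z, h1, h2, h3, h4, h5, h7, h8, k9,
      k11.resolve_left (by omega)⟩)
  rcases k11 with ⟨rfl, rfl⟩ | k11
  · exact Or.inr (Or.inr ⟨a, y, b, x, h2, h1, by omega, h4, h5, h6, k9, k10⟩)
  · exact absurd ⟨a, y, b, x, d, z, h1, h2, h3, h4, h5, h6, h7, h8, k9, k10, k11⟩ hV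

theorem no_three (S : Set ℕ) (h : ∀ x ∈ S, ∀ y ∈ S, ∀ z ∈ S, x < y → y < z → False) :
    S.ncard ≤ 2 := by
  by_contra hc
  push Not at hc
  have hf : S.Finite := Set.finite_of_ncard_pos (by omega)
  obtain ⟨a, b, c, ha, hb, hc, hab, hac, hbc⟩ := (Set.two_lt_ncard_iff hf).1 hc
  have := h a ha b hb c hc
  have := h a ha c hc b hb
  have := h b hb a ha c hc
  have := h b hb c hc a ha
  have := h c hc a ha b hb
  have := h c hc b hb a ha
  grind

theorem cover (S : Set ℕ) (P Q R : ℕ → Prop) (hS : ∀ x ∈ S, P x ∨ Q x ∨ R x)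
    (hP : ∀ x ∈ S, ∀ y ∈ S, ∀ z ∈ S, P x → P y → P z → x < y → y < z → False)
    (hQ : ∀ x ∈ S, ∀ y ∈ S, ∀ z ∈ S, Q x → Q y → Q z → x < y → y < z → False)
    (hR : ∀ x ∈ S, ∀ y ∈ S, ∀ z ∈ S, R x → R y → R z → x < y → y < z → False)
    (hf : S.Finite) :
    S.ncard ≤ 6 := by
  have e : S ⊆ {x ∈ S | P x} ∪ ({x ∈ S | Q x} ∪ {x ∈ S | R x}) := by
    intro x hx
    rcases hS x hx with h | h | h
    · exact Or.inl ⟨hx, h⟩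
    · exact Or.inr (Or.inl ⟨hx, h⟩)
    · exact Or.inr (Or.inr ⟨hx, h⟩)
  have h1 := Set.ncard_le_ncard e (((hf.sep _).union ((hf.sep _).union (hf.sep _))))
  have h2 := Set.ncard_union_le {x ∈ S | P x} ({x ∈ S | Q x} ∪ {x ∈ S | R x})
  have h3 := Set.ncard_union_le {x ∈ S | Q x} {x ∈ S | R x}
  have h4 := no_three {x ∈ S | P x} fun x hx y hy z hz => hP x hx.1 y hy.1 z hz.1 hx.2 hy.2 hz.2
  have h5 := no_three {x ∈ S | Q x} fun x hx y hy z hz => hQ x hx.1 y hy.1 z hz.1 hx.2 hy.2 hz.2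
  have h6 := no_three {x ∈ S | R x} fun x hx y hy z hz => hR x hx.1 y hy.1 z hz.1 hx.2 hy.2 hz.2
  omega

/-- two starts of 0-runs are separated by a 1 -/
theorem between {f : ℕ → Bool} {x y : ℕ} (hx : f x = false)
    (hy : y = 0 ∨ f (y - 1) = true) (h : x < y) : ∃ d, x < d ∧ d < y ∧ f d = true := by
  rcases hy with hy | hy
  · omega
  · refine ⟨y - 1, ?_, by omega, hy⟩
    rcases Nat.lt_or_ge x (y - 1) with h' | h'
    · exact h'
    · have : x = y - 1 := by omega
      rw [this, hy] at hx
      cases hx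

theorem row_bdd : RowBounded (AvF {Q1, Q2}) := by
  refine ⟨6, fun M hM r hr => ?_⟩
  have hV := (mem_AvF _).1 hM.1
  refine cover _ (TT M r) (TL M r) (TR M r) (fun x hx => types hM hr hx.1 hx.2.1) ?_ ?_ ?_
    ((Set.finite_lt_nat M.n).subset fun x hx => hx.1)
  · rintro c₁ ⟨n1, z1, s1⟩ c₂ ⟨n2, z2, s2⟩ c₃ ⟨n3, z3, s3⟩ t1 t2 t3 h12 h23
    obtain ⟨d, hd1, hd2, hd⟩ := between z1 s2 h12
    obtain ⟨e, he1, he2, he⟩ := between z2 s3 h23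
    obtain ⟨b1, x1, b1', y1, p1, p2, p3, p4, p5, p6, p7, p8, p9, p10⟩ := t1
    obtain ⟨b3, x3, b3', y3, q1, q2, q3, q4, q5, q6, q7, q8, q9, q10⟩ := t3
    -- left entries of d, right entries of d
    have kd : ∀ b x b' z, r < b → r < b' → x < d → d < z → b < M.m → b' < M.m → z < M.n →
        M.entry b x = true → M.entry b' z = true → b = b' := by
      intro b x b' z g1 g2 g3 g4 g5 g6 g7 g8 g9
      by_contra hne
      exact hV ⟨r, d, b, x, b', z, g1, g2, hne, g3, g4, g5, g6, g7, hd, g8, g9⟩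
    have ke : ∀ b x b' z, r < b → r < b' → x < e → e < z → b < M.m → b' < M.m → z < M.n →
        M.entry b x = true → M.entry b' z = true → b = b' := by
      intro b x b' z g1 g2 g3 g4 g5 g6 g7 g8 g9
      by_contra hne
      exact hV ⟨r, e, b, x, b', z, g1, g2, hne, g3, g4, g5, g6, g7, he, g8, g9⟩
    have u1 := kd b1 x1 b3' y3 p1 q2 (by omega) (by omega) p6 q7 q8 p9 q10
    rcases Nat.lt_or_ge y1 e with hy | hy
    · have u2 := ke b1' y1 b3' y3 p2 q2 hy (by omega) p7 q7 q8 p10 q10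
      omega
    · have u2 := kd b1 x1 b1' y1 p1 p2 (by omega) (by omega) p6 p7 p8 p9 p10
      omega
  · rintro c₁ ⟨n1, z1, s1⟩ c₂ ⟨n2, z2, s2⟩ c₃ ⟨n3, z3, s3⟩ t1 t2 t3 h12 h23
    obtain ⟨d, hd1, hd2, hd⟩ := between z1 s2 h12
    obtain ⟨a, y, b, z, p1, p2, p3, p4, p5, p6, p7, p8, p9⟩ := t2
    exact hV ⟨a, y, r, d, b, z, p1, p2, p3, by omega, p5, hr, p6, p7, p8, hd, p9⟩
  · rintro c₁ ⟨n1, z1, s1⟩ c₂ ⟨n2, z2, s2⟩ c₃ ⟨n3, z3, s3⟩ t1 t2 t3 h12 h23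
    obtain ⟨d, hd1, hd2, hd⟩ := between z1 s2 h12
    obtain ⟨a, y, b, x, p1, p2, p3, p4, p5, p6, p7, p8⟩ := t1
    exact hV ⟨a, y, b, x, r, d, p2, p1, by omega, p4, by omega, p6, hr, by omega, p7, p8, hd⟩

theorem col_bdd : ColBounded (AvF {Q1, Q2}) := by
  refine ⟨6, fun M hM c hc => ?_⟩
  have hV := (mem_AvF _).1 hM.1
  refine cover _ (fun r => TT M r c) (fun r => TL M r c) (fun r => TR M r c)
    (fun x hx => types hM hx.1 hc hx.2.1) ?_ ?_ ?_
    ((Set.finite_lt_nat M.m).subset fun x hx => hx.1)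
  · rintro r₁ ⟨n1, z1, s1⟩ r₂ ⟨n2, z2, s2⟩ r₃ ⟨n3, z3, s3⟩ t1 t2 t3 h12 h23
    obtain ⟨d, hd1, hd2, hd⟩ := between (f := fun i => M.entry i c) z1 s2 h12
    obtain ⟨b, x, b', z, p1, p2, p3, p4, p5, p6, p7, p8, p9, p10⟩ := t2
    exact hV ⟨d, c, b, x, b', z, by omega, by omega, p3, p4, p5, p6, p7, p8, hd, p9, p10⟩
  · rintro r₁ ⟨n1, z1, s1⟩ r₂ ⟨n2, z2, s2⟩ r₃ ⟨n3, z3, s3⟩ t1 t2 t3 h12 h23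
    obtain ⟨d, hd1, hd2, hd⟩ := between (f := fun i => M.entry i c) z1 s2 h12
    obtain ⟨e, he1, he2, he⟩ := between (f := fun i => M.entry i c) z2 s3 h23
    obtain ⟨a, y, b, z, p1, p2, p3, p4, p5, p6, p7, p8, p9⟩ := t1
    by_cases hb : d = b
    · exact hV ⟨a, y, e, c, b, z, by omega, p2, by omega, p4, p5, by omega, p6, p7, p8, he, p9⟩
    · exact hV ⟨a, y, d, c, b, z, by omega, p2, by omega, p4, p5, by omega, p6, p7, p8, hd, p9⟩
  · rintro r₁ ⟨n1, z1, s1⟩ r₂ ⟨n2, z2, s2⟩ r₃ ⟨n3, z3, s3⟩ t1 t2 t3 h12 h23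
    obtain ⟨d, hd1, hd2, hd⟩ := between (f := fun i => M.entry i c) z1 s2 h12
    obtain ⟨e, he1, he2, he⟩ := between (f := fun i => M.entry i c) z2 s3 h23
    obtain ⟨a, y, b, x, p1, p2, p3, p4, p5, p6, p7, p8⟩ := t1
    by_cases hb : d = b
    · exact hV ⟨a, y, b, x, e, c, p2, by omega, by omega, p4, p5, p6, by omega, hc, p7, p8, he⟩
    · exact hV ⟨a, y, b, x, d, c, p2, by omega, by omega, p4, p5, p6, by omega, hc, p7, p8, hd⟩

/-- the finite set of zeros -/
def zeros (M : BMat) : Finset (ℕ × ℕ) :=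
  (Finset.range M.m ×ˢ Finset.range M.n).filter fun p => M.entry p.1 p.2 = false

theorem exists_critical (C : Set BMat) (k : ℕ) : ∀ M ∈ C, (zeros M).card = k →
    ∃ N, CriticalFor C N ∧ N.m = M.m ∧ N.n = M.n ∧
      ∀ i j, M.entry i j = true → N.entry i j = true := by
  induction k using Nat.strong_induction_on with
  | _ k ih =>
    intro M hM hk
    by_cases hcr : CriticalFor C M
    · exact ⟨M, hcr, rfl, rfl, fun _ _ h => h⟩
    · have : ∃ i j, i < M.m ∧ j < M.n ∧ M.entry i j = false ∧ setOne M i j ∈ C := by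
        by_contra hne
        push Not at hne
        exact hcr ⟨hM, hne⟩
      obtain ⟨i, j, hi, hj, h0, hS⟩ := this
      have hlt : (zeros (setOne M i j)).card < k := by
        rw [← hk]
        apply Finset.card_lt_card
        rw [Finset.ssubset_iff_of_subset]
        · exact ⟨(i, j), by simp [zeros, hi, hj, h0], by simp [zeros, setOne]⟩
        · rintro ⟨p, q⟩ h
          rw [zeros, Finset.mem_filter] at h ⊢
          refine ⟨h.1, ?_⟩
          have h2 := h.2
          simp only [setOne] at h2
          split_ifs at h2
          exact h2
      obtain ⟨N, h1, h2, h3, h4⟩ := ih _ hlt _ hS rfl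
      refine ⟨N, h1, h2, h3, fun a b h => h4 a b ?_⟩
      simp [setOne, h]

/-- The unbounded family. -/
def W (t : Bool) (N : ℕ) : BMat :=
  ⟨N + 3, 2 * N + 1, fun p q => decide (q % 2 = 0 ∧ (p = 0 ∨
    if t then (p + q / 2 = N ∨ p + q / 2 = N + 2) else (p = q / 2 ∨ p = q / 2 + 2)))⟩

theorem W_avoids (t : Bool) (N : ℕ) : ¬ H t (W t N) := by
  rintro ⟨a, b, c, x, y, z, hab, hbc, hc, hxy, hyz, hz, h1, h2, h3⟩
  cases t <;> simp [W] at * <;> omega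

theorem unb (t : Bool) : ¬ RowBounded (Av (Qt t)) := by
  rintro ⟨K, hK⟩
  obtain ⟨M, hM, hm, hn, hle⟩ :=
    exists_critical (Av (Qt t)) _ (W t (K + 1)) ((mem_Av _ _).2 (W_avoids _ _)) rfl
  have hA := (mem_Av _ _).1 hM.1
  have hr := hK M hM 0 (by rw [hm]; simp [W])
  simp only [W] at hm hn
  have hsub : ((Finset.range (K + 1)).image fun i => 2 * i + 1 : Set ℕ) ⊆
      {j | j < M.n ∧ M.entry 0 j = false ∧ (j = 0 ∨ M.entry 0 (j - 1) = true)} := by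
    intro j hj
    simp only [Finset.coe_image, Set.mem_image, Finset.coe_range, Set.mem_Iio] at hj
    obtain ⟨i, hi, rfl⟩ := hj
    refine ⟨by omega, ?_, Or.inr (hle _ _ ?_)⟩
    · by_contra h
      rw [Bool.not_eq_false] at h
      apply hA
      cases t
      · refine ⟨0, i + 1, i + 2, 2 * i, 2 * i + 1, 2 * i + 2, by omega, by omega, by omega,
          by omega, by omega, by omega, h, hle _ _ ?_, hle _ _ ?_⟩
        · simp [W]
        · simp [W]
      · refine ⟨0, K + 1 - i, K + 1 - i + 1, 2 * i, 2 * i + 1, 2 * i + 2, by omega, by omega,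
          by omega, by omega, by omega, by omega, h, hle _ _ ?_, hle _ _ ?_⟩
        · simp [W]; omega
        · simp [W]; omega
    · simp [W]
  have h1 := Set.ncard_le_ncard hsub ((Set.finite_lt_nat M.n).subset fun x hx => hx.1)
  rw [Set.ncard_coe_finset, Finset.card_image_of_injective _ (fun a b h => by
    have h' : 2 * a + 1 = 2 * b + 1 := h
    omega), Finset.card_range] at h1
  simp only [rowRunCount] at hr
  omega

end BMat

/-- **Proposition (pro-unbinter).** The class `Av({Q₁, Q₂})` is bounded, even
though each of `Av(Q₁)` and `Av(Q₂)` is unbounded. -/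
theorem stmt_19 :
    Bounded (AvF {Q1, Q2}) ∧ ¬ Bounded (Av Q1) ∧ ¬ Bounded (Av Q2) := by
  exact ⟨⟨row_bdd, col_bdd⟩, fun h => unb true h.1, fun h => unb false h.1⟩
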